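/- Let G be a countable discrete residually finite group with profinite completion Ḡ, and let n ≥ 1. Equip Ḡ^{∗(n)} (the n-fold topological join of Ḡ) with the n-fold join β^{∗(n)} of the left-translation action β of G on Ḡ, and equip each (G/H)^{∗(n)}, H ∈ I_G, with the n-fold join of the left-translation action of G on G/H, the connecting maps being the n-fold joins φ_{K,H}^{∗(n)} of the quotient maps φ_{K,H} : G/K → G/H. Then there is a G-equivariant homeomorphism Ḡ^{∗(n)} ≅ lim_{H ∈ I_G} (G/H)^{∗(n)}. -/

import Mathlib

/-- The relation generating the topological join: at `t = 0` the first coordinate is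
collapsed, at `t = 1` the second coordinate is collapsed. -/
def JoinRel (X Y : Type*) :
    (unitInterval × X × Y) → (unitInterval × X × Y) → Prop := fun p q =>
  (p.1 = 0 ∧ q.1 = 0 ∧ p.2.2 = q.2.2) ∨ (p.1 = 1 ∧ q.1 = 1 ∧ p.2.1 = q.2.1)

/-- The topological join `X ∗ Y` of two topological spaces. -/
def TopJoin (X Y : Type*) : Type _ := Quot (JoinRel X Y)

instance TopJoin.topology (X Y : Type*) [TopologicalSpace X] [TopologicalSpace Y] :
    TopologicalSpace (TopJoin X Y) :=
  inferInstanceAs (TopologicalSpace (Quot (JoinRel X Y)))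

/-- The class `[t, x, y] ∈ X ∗ Y`. -/
def joinMk {X Y : Type*} (t : unitInterval) (x : X) (y : Y) : TopJoin X Y :=
  Quot.mk _ (t, x, y)

/-- The join `f ∗ g` of two maps, `[t,x,y] ↦ [t, f x, g y]`. -/
def TopJoin.map {X₁ X₂ Y₁ Y₂ : Type*} (f : X₁ → X₂) (g : Y₁ → Y₂) :
    TopJoin X₁ Y₁ → TopJoin X₂ Y₂ :=
  Quot.map (fun p => (p.1, f p.2.1, g p.2.2)) (fun p q h => by
    rcases h with ⟨h1, h2, h3⟩ | ⟨h1, h2, h3⟩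
    · exact Or.inl ⟨h1, h2, congrArg g h3⟩
    · exact Or.inr ⟨h1, h2, congrArg f h3⟩)

/-- The natural map `G ⧸ H → G ⧸ K` of coset spaces, `gH ↦ gK`, for `H ≤ K`. -/
def cosetMap {G : Type*} [Group G] {H K : Subgroup G} (h : H ≤ K) : G ⧸ H → G ⧸ K :=
  Quotient.map' id fun a b hab => by
    rw [QuotientGroup.leftRel_apply] at hab ⊢
    exact h hab

/-- Each coset space of the discrete group `G` carries the discrete topology. -/
instance quotDiscTopology {G : Type*} [Group G] (H : Subgroup G) :
    TopologicalSpace (G ⧸ H) := ⊥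

/-- The index set `I_G` of finite-index normal subgroups of `G`. -/
abbrev FinIdxNml (G : Type*) [Group G] : Type _ :=
  {H : Subgroup G // H.Normal ∧ H.FiniteIndex}

/-- The profinite completion of `G`: the inverse limit of the finite quotients `G ⧸ H`
over `H ∈ I_G`, directed by reverse inclusion. -/
abbrev ProfComp (G : Type*) [Group G] : Type _ :=
  { x : ∀ H : FinIdxNml G, G ⧸ H.1 //
    ∀ (H K : FinIdxNml G) (h : K.1 ≤ H.1), cosetMap h (x K) = x H }

/-- The canonical map `ι : G → Ḡ`, `g ↦ (gH)_{H ∈ I_G}`. -/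
def profIota (G : Type*) [Group G] : G → ProfComp G :=
  fun g => ⟨fun _ => QuotientGroup.mk g, fun _ _ _ => rfl⟩

/-- The left-translation action `β` of `G` on its profinite completion. -/
def profTrans {G : Type*} [Group G] (t : G) (x : ProfComp G) : ProfComp G :=
  ⟨fun H => t • x.1 H, by
    intro H K h
    have key : ∀ q : G ⧸ K.1, cosetMap h (t • q) = t • cosetMap h q := by
      intro q
      induction q using Quotient.inductionOn' with
      | h g => rfl
    rw [key, x.2 H K h]⟩

/-- `JoinIter X d` is the `(d+1)`-fold topological join `X ∗ X ∗ ⋯ ∗ X`. -/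
def JoinIter (X : Type*) : ℕ → Type _
  | 0 => X
  | n + 1 => TopJoin (JoinIter X n) X

instance JoinIter.topologicalSpace (X : Type*) [tX : TopologicalSpace X] :
    ∀ n, TopologicalSpace (JoinIter X n)
  | 0 => tX
  | n + 1 => @TopJoin.topology _ _ (JoinIter.topologicalSpace X n) tX

/-- The iterated join `f^{∗(d+1)}` of a map with itself. -/
def JoinIter.map {X Y : Type*} (f : X → Y) : ∀ n, JoinIter X n → JoinIter Y n
  | 0 => f
  | n + 1 => TopJoin.map (JoinIter.map f n) f

/-- The inverse limit of the iterated joins `(G ⧸ H)^{∗(d+1)}` over `H ∈ I_G`, with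
connecting maps the iterated joins of the quotient maps. -/
abbrev JoinProfLim (G : Type*) [Group G] (d : ℕ) : Type _ :=
  { x : ∀ H : FinIdxNml G, JoinIter (G ⧸ H.1) d //
    ∀ (H K : FinIdxNml G) (h : K.1 ≤ H.1), JoinIter.map (cosetMap h) d (x K) = x H }

section TopJoin

variable {X Y X₁ X₂ Y₁ Y₂ : Type*}

theorem joinMk_surjective (p : TopJoin X Y) : ∃ t x y, joinMk (X := X) (Y := Y) t x y = p := by
  induction p using Quot.ind with
  | mk p => exact ⟨p.1, p.2.1, p.2.2, rfl⟩

theorem joinMk_eq_joinMk_iff {t t' : unitInterval} {x x' : X} {y y' : Y} :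
    joinMk t x y = joinMk t' x' y' ↔ t = t' ∧ (t ≠ 0 → x = x') ∧ (t ≠ 1 → y = y') := by
  constructor
  · intro h
    have h' := Quot.eqvGen_exact h
    let R : unitInterval × X × Y → unitInterval × X × Y → Prop := fun p q =>
      p.1 = q.1 ∧ (p.1 ≠ 0 → p.2.1 = q.2.1) ∧ (p.1 ≠ 1 → p.2.2 = q.2.2)
    suffices ∀ p q, Relation.EqvGen (JoinRel X Y) p q → R p q from this _ _ h'
    intro p q hpq
    induction hpq with
    | rel p q h =>
      rcases h with ⟨h1, h2, h3⟩ | ⟨h1, h2, h3⟩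
      · exact ⟨h1.trans h2.symm, fun h => absurd h1 h, fun _ => h3⟩
      · exact ⟨h1.trans h2.symm, fun _ => h3, fun h => absurd h1 h⟩
    | refl p => exact ⟨rfl, fun _ => rfl, fun _ => rfl⟩
    | symm p q _ ih =>
      exact ⟨ih.1.symm, fun h => (ih.2.1 (ih.1 ▸ h)).symm, fun h => (ih.2.2 (ih.1 ▸ h)).symm⟩
    | trans p q r _ _ ih₁ ih₂ =>
      exact ⟨ih₁.1.trans ih₂.1, fun h => (ih₁.2.1 h).trans (ih₂.2.1 (ih₁.1 ▸ h)),
        fun h => (ih₁.2.2 h).trans (ih₂.2.2 (ih₁.1 ▸ h))⟩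
  · rintro ⟨rfl, hx, hy⟩
    by_cases h0 : t = 0
    · have h1 : t ≠ 1 := by rw [h0]; exact zero_ne_one
      exact Quot.sound (Or.inl ⟨h0, h0, hy h1⟩)
    · by_cases h1 : t = 1
      · exact Quot.sound (Or.inr ⟨h1, h1, hx h0⟩)
      · rw [hx h0, hy h1]

theorem TopJoin.map_joinMk (f : X₁ → X₂) (g : Y₁ → Y₂) (t : unitInterval) (x : X₁) (y : Y₁) :
    TopJoin.map f g (joinMk t x y) = joinMk t (f x) (g y) := rfl

theorem TopJoin.continuous_map [TopologicalSpace X₁] [TopologicalSpace X₂] [TopologicalSpace Y₁]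
    [TopologicalSpace Y₂] {f : X₁ → X₂} {g : Y₁ → Y₂} (hf : Continuous f) (hg : Continuous g) :
    Continuous (TopJoin.map f g) :=
  continuous_quot_lift _ (continuous_quot_mk.comp (by fun_prop :
    Continuous fun p : unitInterval × X₁ × Y₁ => (p.1, f p.2.1, g p.2.2)))

instance TopJoin.compactSpace [TopologicalSpace X] [TopologicalSpace Y] [CompactSpace X]
    [CompactSpace Y] : CompactSpace (TopJoin X Y) :=
  inferInstanceAs (CompactSpace (Quot (JoinRel X Y)))

/-- Continuous real-valued functions separate the points of `X`. -/
def SeparatesByReal (X : Type*) [TopologicalSpace X] : Prop :=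
  ∀ x y : X, x ≠ y → ∃ f : X → ℝ, Continuous f ∧ f x ≠ f y

theorem SeparatesByReal.t2Space [TopologicalSpace X] (h : SeparatesByReal X) : T2Space X :=
  ⟨fun x y hxy =>
    have ⟨_, hf, hne⟩ := h x y hxy
    separated_by_continuous hf hne⟩

theorem separatesByReal_of_discreteTopology [TopologicalSpace X] [DiscreteTopology X] :
    SeparatesByReal X := by
  classical
  exact fun x y hxy => ⟨fun z => if z = x then 1 else 0, continuous_of_discreteTopology,
    by simp [hxy.symm]⟩

theorem SeparatesByReal.topJoin [TopologicalSpace X] [TopologicalSpace Y]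
    (hX : SeparatesByReal X) (hY : SeparatesByReal Y) : SeparatesByReal (TopJoin X Y) := by
  intro p q hpq
  obtain ⟨t, x, y, rfl⟩ := joinMk_surjective p
  obtain ⟨t', x', y', rfl⟩ := joinMk_surjective q
  by_cases htt : t = t'
  · subst htt
    by_cases hx : t ≠ 0 → x = x'
    · have hy : ¬ (t ≠ 1 → y = y') := fun hy => hpq (joinMk_eq_joinMk_iff.2 ⟨rfl, hx, hy⟩)
      push Not at hy
      obtain ⟨g, hg, hne⟩ := hY y y' hy.2
      refine ⟨Quot.lift (fun p => (1 - (p.1 : ℝ)) * g p.2.2) ?_,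
        continuous_quot_lift _ (by fun_prop), ?_⟩
      · rintro a b (⟨h1, h2, h3⟩ | ⟨h1, h2, h3⟩) <;> simp [h1, h2, h3]
      · have h1 : 1 - (t : ℝ) ≠ 0 := fun h => hy.1 (Subtype.ext (sub_eq_zero.1 h).symm)
        exact fun h => hne (mul_left_cancel₀ h1 h)
    · push Not at hx
      obtain ⟨f, hf, hne⟩ := hX x x' hx.2
      refine ⟨Quot.lift (fun p => (p.1 : ℝ) * f p.2.1) ?_,
        continuous_quot_lift _ (by fun_prop), ?_⟩
      · rintro a b (⟨h1, h2, h3⟩ | ⟨h1, h2, h3⟩) <;> simp [h1, h2, h3]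
      · have h0 : (t : ℝ) ≠ 0 := fun h => hx.1 (Subtype.ext h)
        exact fun h => hne (mul_left_cancel₀ h0 h)
  · refine ⟨Quot.lift (fun p => (p.1 : ℝ)) ?_, continuous_quot_lift _ (by fun_prop),
      fun h => htt (Subtype.ext h)⟩
    rintro a b (⟨h1, h2, -⟩ | ⟨h1, h2, -⟩) <;> rw [h1, h2]

end TopJoin

section JoinIter

variable {X Y Z : Type*}

theorem JoinIter.map_map (g : Y → Z) (f : X → Y) (n : ℕ) (p : JoinIter X n) :
    JoinIter.map g n (JoinIter.map f n p) = JoinIter.map (fun x => g (f x)) n p := by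
  induction n with
  | zero => rfl
  | succ n ih =>
    obtain ⟨t, x, y, rfl⟩ := joinMk_surjective p
    exact congrArg (fun x' => joinMk t x' (g (f y))) (ih x)

theorem JoinIter.continuous_map [TopologicalSpace X] [TopologicalSpace Y] {f : X → Y}
    (hf : Continuous f) (n : ℕ) : Continuous (JoinIter.map f n) := by
  induction n with
  | zero => exact hf
  | succ n ih => exact TopJoin.continuous_map ih hf

theorem JoinIter.compactSpace [TopologicalSpace X] [CompactSpace X] (n : ℕ) :
    CompactSpace (JoinIter X n) := by
  induction n with
  | zero => assumption
  | succ n ih => exact TopJoin.compactSpace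

theorem SeparatesByReal.joinIter [TopologicalSpace X] (hX : SeparatesByReal X) (n : ℕ) :
    SeparatesByReal (JoinIter X n) := by
  induction n with
  | zero => exact hX
  | succ n ih => exact ih.topJoin hX

theorem JoinIter.nonempty [Nonempty X] (n : ℕ) : Nonempty (JoinIter X n) := by
  induction n with
  | zero => assumption
  | succ n ih =>
    obtain ⟨x⟩ := ih
    obtain ⟨y⟩ := ‹Nonempty X›
    exact ⟨joinMk 0 x y⟩

end JoinIter

section ProfComp

variable {G : Type*} [Group G]

instance discreteTopology_quotient (H : Subgroup G) : DiscreteTopology (G ⧸ H) := ⟨rfl⟩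

instance ProfComp.compactSpace : CompactSpace (ProfComp G) := by
  have hfin (H : FinIdxNml G) : Finite (G ⧸ H.1) :=
    have := H.2.2
    inferInstance
  refine isCompact_iff_compactSpace.1 (IsClosed.isCompact (s := {x : ∀ H : FinIdxNml G, G ⧸ H.1 |
    ∀ (H K : FinIdxNml G) (h : K.1 ≤ H.1), cosetMap h (x K) = x H}) ?_)
  simp only [Set.ofPred_forall]
  exact isClosed_iInter fun H => isClosed_iInter fun K => isClosed_iInter fun h =>
    isClosed_eq (continuous_of_discreteTopology.comp (continuous_apply K)) (continuous_apply H)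

/-- The comparison map `Ḡ^{∗(d+1)} → lim_H (G ⧸ H)^{∗(d+1)}` induced by the projections. -/
def joinToLim (d : ℕ) (p : JoinIter (ProfComp G) d) : JoinProfLim G d :=
  ⟨fun H => JoinIter.map (fun x : ProfComp G => x.1 H) d p, fun H K h => by
    rw [JoinIter.map_map]
    exact congrArg (fun f => JoinIter.map f d p) (funext fun x => x.2 H K h)⟩

theorem continuous_joinToLim (d : ℕ) : Continuous (joinToLim (G := G) d) :=
  Continuous.subtype_mk (continuous_pi fun H => JoinIter.continuous_map
    ((continuous_apply H).comp continuous_subtype_val) d) _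

theorem joinToLim_injective (d : ℕ) : Function.Injective (joinToLim (G := G) d) := by
  suffices ∀ p q : JoinIter (ProfComp G) d, (∀ H : FinIdxNml G,
      JoinIter.map (fun x : ProfComp G => x.1 H) d p =
        JoinIter.map (fun x : ProfComp G => x.1 H) d q) → p = q from
    fun p q h => this p q fun H => congrFun (congrArg Subtype.val h) H
  induction d with
  | zero => exact fun p q h => Subtype.ext (funext h)
  | succ d ih =>
    intro p q h
    obtain ⟨t, x, y, rfl⟩ := joinMk_surjective p
    obtain ⟨t', x', y', rfl⟩ := joinMk_surjective q
    have key (H : FinIdxNml G) := joinMk_eq_joinMk_iff.1 (h H)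
    exact joinMk_eq_joinMk_iff.2 ⟨(key ⟨⊤, inferInstance, inferInstance⟩).1,
      fun h0 => ih x x' fun H => (key H).2.1 h0,
      fun h1 => Subtype.ext (funext fun H => (key H).2.2 h1)⟩

theorem joinToLim_surjective (d : ℕ) : Function.Surjective (joinToLim (G := G) d) := by
  have : Nonempty (ProfComp G) := ⟨profIota G 1⟩
  induction d with
  | zero => exact fun z => ⟨⟨z.1, z.2⟩, rfl⟩
  | succ d ih =>
    intro z
    choose t x y hz using fun H => joinMk_surjective (z.1 H)
    have key (H K : FinIdxNml G) (h : K.1 ≤ H.1) : t K = t H ∧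
        (t K ≠ 0 → JoinIter.map (cosetMap h) d (x K) = x H) ∧
        (t K ≠ 1 → cosetMap h (y K) = y H) := by
      have hzz := z.2 H K h
      rw [← hz K, ← hz H] at hzz
      exact joinMk_eq_joinMk_iff.1 hzz
    let T : FinIdxNml G := ⟨⊤, inferInstance, inferInstance⟩
    have ht (H : FinIdxNml G) : t H = t T := (key T H le_top).1
    have hx : ∃ x₀ : JoinIter (ProfComp G) d, t T ≠ 0 → ∀ H : FinIdxNml G,
        JoinIter.map (fun x : ProfComp G => x.1 H) d x₀ = x H := by
      by_cases h0 : t T = 0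
      · exact ⟨(JoinIter.nonempty d).some, fun h => absurd h0 h⟩
      · obtain ⟨x₀, hx₀⟩ := ih ⟨x, fun H K h => (key H K h).2.1 (by rwa [ht K])⟩
        exact ⟨x₀, fun _ H => congrFun (congrArg Subtype.val hx₀) H⟩
    have hy : ∃ y₀ : ProfComp G, t T ≠ 1 → ∀ H : FinIdxNml G, y₀.1 H = y H := by
      by_cases h1 : t T = 1
      · exact ⟨profIota G 1, fun h => absurd h1 h⟩
      · exact ⟨⟨y, fun H K h => (key H K h).2.2 (by rwa [ht K])⟩, fun _ _ => rfl⟩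
    obtain ⟨x₀, hx₀⟩ := hx
    obtain ⟨y₀, hy₀⟩ := hy
    refine ⟨joinMk (t T) x₀ y₀, Subtype.ext (funext fun H => ?_)⟩
    rw [← hz H]
    exact joinMk_eq_joinMk_iff.2 ⟨(ht H).symm, fun h0 => hx₀ h0 H, fun h1 => hy₀ h1 H⟩

end ProfComp

/-- For a countable discrete residually finite group `G` and `d ≥ 0`, there is a
`G`-equivariant homeomorphism `Ḡ^{∗(d+1)} ≅ lim_{H ∈ I_G} (G ⧸ H)^{∗(d+1)}`, the actions
being the iterated joins of the left-translation actions. -/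
theorem stmt_14 (G : Type*) [Group G] [Countable G]
    (hres : ∀ g : G, g ≠ 1 → ∃ H : Subgroup G, H.Normal ∧ H.FiniteIndex ∧ g ∉ H)
    (d : ℕ) :
    ∃ Θ : JoinIter (ProfComp G) d ≃ₜ JoinProfLim G d,
      ∀ (t : G) (x : JoinIter (ProfComp G) d) (H : FinIdxNml G),
        (Θ (JoinIter.map (profTrans t) d x)).1 H =
          JoinIter.map (fun q : G ⧸ H.1 => t • q) d ((Θ x).1 H) := by
  have (H : FinIdxNml G) : T2Space (JoinIter (G ⧸ H.1) d) :=
    (separatesByReal_of_discreteTopology.joinIter d).t2Space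
  have : CompactSpace (JoinIter (ProfComp G) d) := JoinIter.compactSpace d
  refine ⟨Continuous.homeoOfEquivCompactToT2
    (f := Equiv.ofBijective _ ⟨joinToLim_injective d, joinToLim_surjective d⟩)
    (continuous_joinToLim d), fun t x H => ?_⟩
  exact (JoinIter.map_map _ _ d x).trans (JoinIter.map_map _ _ d x).symm
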